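/- Let A_0A_1…A_m and B_0B_1…B_l be broken lines in ℝ² with LLS-sequences (a_0,…,a_{2m−2}) and (b_0,…,b_{2l−2}) with respect to the origin O. Suppose B_0 = A_0, the first edges are parallel (B_1 − B_0 = μ(A_1 − A_0) for some μ ≠ 0), and the values of the corresponding continued fractions coincide: the continuants satisfy q_{2m−2}(a) ≠ 0, q_{2l−2}(b) ≠ 0 and p_{2m−2}(a)/q_{2m−2}(a) = p_{2l−2}(b)/q_{2l−2}(b). Then the points A_m, B_l and the origin O lie on one line, i.e., A_m × B_l = 0. -/

import Mathlib

/-- Oriented area of the parallelogram spanned by two vectors of `ℝ²`. -/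
def cross (v w : ℝ × ℝ) : ℝ := v.1 * w.2 - v.2 * w.1

/-- Edge elements of an LLS-sequence: `a (2k) = A k × A (k+1)`. -/
def edgeElem (A : ℕ → ℝ × ℝ) (k : ℕ) : ℝ := cross (A k) (A (k + 1))

/-- Angle elements of an LLS-sequence:
`a (2k-1) = ((A (k-1) - A k) × (A (k+1) - A k)) / (a (2k-2) * a (2k))`. -/
noncomputable def angleElem (A : ℕ → ℝ × ℝ) (k : ℕ) : ℝ :=
  cross (A (k - 1) - A k) (A (k + 1) - A k) / (edgeElem A (k - 1) * edgeElem A k)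

/-- The LLS-sequence of a broken line `A` with respect to the origin:
`lls A (2k) = edgeElem A k` and `lls A (2k-1) = angleElem A k`. -/
noncomputable def lls (A : ℕ → ℝ × ℝ) (j : ℕ) : ℝ :=
  if j % 2 = 0 then edgeElem A (j / 2) else angleElem A ((j + 1) / 2)

/-- Continuant numerators `p k` of a sequence `a`:
`p (-2) = 0`, `p (-1) = 1`, `p k = a k * p (k-1) + p (k-2)`. -/
def contP (a : ℕ → ℝ) : ℕ → ℝ
  | 0 => a 0
  | 1 => a 1 * a 0 + 1
  | (k + 2) => a (k + 2) * contP a (k + 1) + contP a k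

/-- Continuant denominators `q k` of a sequence `a`:
`q (-2) = 1`, `q (-1) = 0`, `q k = a k * q (k-1) + q (k-2)`. -/
def contQ (a : ℕ → ℝ) : ℕ → ℝ
  | 0 => 1
  | 1 => a 1
  | (k + 2) => a (k + 2) * contQ a (k + 1) + contQ a k

/-- The edge `A k A (k+1)` scaled so that its oriented area with `A k` is one. -/
noncomputable def unitEdge (A : ℕ → ℝ × ℝ) (k : ℕ) : ℝ × ℝ :=
  (edgeElem A k)⁻¹ • (A (k + 1) - A k)

/-- The vector with coordinates `(q j, p j)` in the frame `(e, f)`. -/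
def contVec (a : ℕ → ℝ) (e f : ℝ × ℝ) (j : ℕ) : ℝ × ℝ := contQ a j • e + contP a j • f

lemma contVec_add_two (a : ℕ → ℝ) (e f : ℝ × ℝ) (j : ℕ) :
    contVec a e f (j + 2) = contVec a e f j + a (j + 2) • contVec a e f (j + 1) := by
  simp only [contVec, contQ, contP]
  module

lemma lls_two_mul (A : ℕ → ℝ × ℝ) (k : ℕ) : lls A (2 * k) = edgeElem A k := by
  simp [lls]

lemma lls_two_mul_add_one (A : ℕ → ℝ × ℝ) (k : ℕ) :
    lls A (2 * k + 1) = angleElem A (k + 1) := by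
  rw [lls, if_neg (by omega), show (2 * k + 1 + 1) / 2 = k + 1 by omega]

lemma add_edgeElem_smul_unitEdge {A : ℕ → ℝ × ℝ} {k : ℕ} (h : edgeElem A k ≠ 0) :
    A k + edgeElem A k • unitEdge A k = A (k + 1) := by
  rw [unitEdge, smul_inv_smul₀ h, add_sub_cancel]

lemma unitEdge_succ {A : ℕ → ℝ × ℝ} {k : ℕ} (h : edgeElem A k ≠ 0)
    (h' : edgeElem A (k + 1) ≠ 0) :
    unitEdge A (k + 1) = unitEdge A k + angleElem A (k + 1) • A (k + 1) := by
  rw [unitEdge, unitEdge, angleElem, Nat.add_sub_cancel]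
  ext <;> simp only [Prod.fst_add, Prod.snd_add, Prod.smul_fst, Prod.smul_snd, Prod.fst_sub,
    Prod.snd_sub, smul_eq_mul, cross] <;> field_simp <;> simp only [edgeElem, cross] <;> ring

/-- The vertices and scaled edges of a broken line have the continuants of its LLS-sequence as
coordinates in the frame `(A 0, unitEdge A 0)`. -/
lemma eq_contVec {m : ℕ} {A : ℕ → ℝ × ℝ} (hA : ∀ k < m, edgeElem A k ≠ 0) (k : ℕ) (hk : k < m) :
    A (k + 1) = contVec (lls A) (A 0) (unitEdge A 0) (2 * k) ∧
      (k + 1 < m →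
        unitEdge A (k + 1) = contVec (lls A) (A 0) (unitEdge A 0) (2 * k + 1)) := by
  induction k with
  | zero =>
    have h1 := add_edgeElem_smul_unitEdge (hA 0 hk)
    have e0 := lls_two_mul A 0
    have e1 := lls_two_mul_add_one A 0
    simp only [mul_zero, zero_add] at e0 e1 h1 ⊢
    refine ⟨by simp [contVec, contQ, contP, e0, h1], fun h => ?_⟩
    have h2 := unitEdge_succ (hA 0 hk) (hA 1 h)
    simp only [zero_add] at h2
    rw [h2, ← h1]
    simp only [contVec, contQ, contP, e0, e1]
    module
  | succ k ih =>
    obtain ⟨h1, h2⟩ := ih (by omega)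
    have h3 : A (k + 1 + 1) = contVec (lls A) (A 0) (unitEdge A 0) (2 * k + 2) := by
      rw [contVec_add_two, ← h1, ← h2 hk, show 2 * k + 2 = 2 * (k + 1) by ring, lls_two_mul,
        add_edgeElem_smul_unitEdge (hA _ hk)]
    refine ⟨h3, fun h => ?_⟩
    rw [unitEdge_succ (hA _ hk) (hA _ h), h2 hk, h3, ← lls_two_mul_add_one]
    exact (contVec_add_two _ _ _ _).symm

lemma cross_contVec (a b : ℕ → ℝ) (e f : ℝ × ℝ) (i j : ℕ) :
    cross (contVec a e f i) (contVec b e f j) =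
      (contQ a i * contP b j - contP a i * contQ b j) * cross e f := by
  simp only [cross, contVec, Prod.fst_add, Prod.snd_add, Prod.smul_fst, Prod.smul_snd,
    smul_eq_mul]
  ring

lemma unitEdge_zero_eq {A B : ℕ → ℝ × ℝ} {μ : ℝ} (hμ : μ ≠ 0) (h0 : B 0 = A 0)
    (hdir : B 1 - B 0 = μ • (A 1 - A 0)) : unitEdge B 0 = unitEdge A 0 := by
  have hedge : edgeElem B 0 = μ * edgeElem A 0 := by
    have h1 : B 1 = A 0 + μ • (A 1 - A 0) := by rw [← hdir, h0, add_sub_cancel]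
    simp only [edgeElem, cross, zero_add, h0, h1, Prod.fst_add, Prod.snd_add, Prod.smul_fst,
      Prod.smul_snd, Prod.fst_sub, Prod.snd_sub, smul_eq_mul]
    ring
  rw [unitEdge, unitEdge, hedge, zero_add, hdir, mul_inv_rev, mul_smul, inv_smul_smul₀ hμ]

/-- **Broken lines with the same continued fraction end on one line through the origin.**
Let `A 0 … A m` and `B 0 … B l` be broken lines with respect to the origin with
`B 0 = A 0` and parallel first edges, whose corresponding continued fractions have equal
(finite) values. Then the points `A m`, `B l` and the origin lie on one line. -/
theorem endpoints_collinear_of_eq_continued_fraction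
    (m l : ℕ) (hm : 1 ≤ m) (hl : 1 ≤ l) (A B : ℕ → ℝ × ℝ)
    (hA : ∀ k < m, cross (A k) (A (k + 1)) ≠ 0)
    (hB : ∀ k < l, cross (B k) (B (k + 1)) ≠ 0)
    (hB0 : B 0 = A 0)
    (μ : ℝ) (hμ : μ ≠ 0) (hdir : B 1 - B 0 = μ • (A 1 - A 0))
    (hqa : contQ (lls A) (2 * m - 2) ≠ 0)
    (hqb : contQ (lls B) (2 * l - 2) ≠ 0)
    (hval : contP (lls A) (2 * m - 2) / contQ (lls A) (2 * m - 2)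
          = contP (lls B) (2 * l - 2) / contQ (lls B) (2 * l - 2)) :
    cross (A m) (B l) = 0 := by
  obtain ⟨m, rfl⟩ := Nat.exists_eq_add_of_le' hm
  obtain ⟨l, rfl⟩ := Nat.exists_eq_add_of_le' hl
  rw [show 2 * (m + 1) - 2 = 2 * m by omega] at hqa hval
  rw [show 2 * (l + 1) - 2 = 2 * l by omega] at hqb hval
  rw [div_eq_div_iff hqa hqb] at hval
  rw [(eq_contVec hA m m.lt_succ_self).1, (eq_contVec hB l l.lt_succ_self).1, hB0,
    unitEdge_zero_eq hμ hB0 hdir, cross_contVec, hval, mul_comm, mul_comm (contQ _ _), sub_self,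
    mul_zero]
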